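/- arXiv:1605.03074 — 2 statements merged into one kernel-verified Lean document; each statement's English description precedes it below -/
import Mathlib

section
/- Every natural number n can be written as n = x^2 + y^2 + z^2 + w^2 with x, y, z, w integers such that w·(x + 2y + 3z) = 0. -/
/-- Every positive definite binary integral form of determinant `D` is equivalent to one whose
leading coefficient `m` satisfies `3 * m ^ 2 ≤ 4 * D`. -/
lemma exists_unimodular_small_leading_coeff (A B C : ℤ) (hA : 0 < A) (hD : 0 < A * C - B ^ 2) :
    ∃ p q r s : ℤ, p * s - q * r = 1 ∧ 0 < A * p ^ 2 + 2 * B * p * r + C * r ^ 2 ∧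
      3 * (A * p ^ 2 + 2 * B * p * r + C * r ^ 2) ^ 2 ≤ 4 * (A * C - B ^ 2) := by
  induction hN : A.toNat using Nat.strong_induction_on generalizing A B C with
  | _ N ih =>
    obtain ⟨k, h1, h2⟩ : ∃ k : ℤ, -A ≤ 2 * (B - k * A) ∧ 2 * (B - k * A) ≤ A := by
      refine ⟨(2 * B + A) / (2 * A), ?_, ?_⟩
      · linarith [Int.mul_ediv_self_le (x := 2 * B + A) (k := 2 * A) (by omega)]
      · linarith [Int.lt_mul_ediv_self_add (x := 2 * B + A) (k := 2 * A) (by omega)]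
    obtain ⟨B', hB'⟩ : ∃ B', B' = B - k * A := ⟨_, rfl⟩
    obtain ⟨C', hC'⟩ : ∃ C', C' = C - 2 * k * B + k ^ 2 * A := ⟨_, rfl⟩
    rw [← hB'] at h1 h2
    have hdet : A * C' - B' ^ 2 = A * C - B ^ 2 := by rw [hB', hC']; ring
    have hsq : 4 * B' ^ 2 ≤ A ^ 2 := by nlinarith
    by_cases hlt : C' < A
    · have hCpos : 0 < C' := by
        by_contra! hneg
        nlinarith [sq_nonneg B']
      obtain ⟨p, q, r, s, hdet1, hpos, hle⟩ :=
        ih C'.toNat (by omega) C' (-B') A hCpos (by linarith) rfl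
      have hval : A * (r + k * p) ^ 2 + 2 * B * (r + k * p) * (-p) + C * (-p) ^ 2 =
          C' * p ^ 2 + 2 * (-B') * p * r + A * r ^ 2 := by rw [hB', hC']; ring
      refine ⟨r + k * p, s + k * q, -p, -q, by linear_combination hdet1, ?_, ?_⟩
      · rwa [hval]
      · rw [hval]; linarith
    · refine ⟨1, 0, 0, 1, by norm_num, by simpa using hA, ?_⟩
      push Not at hlt
      have : A * A ≤ A * C' := by gcongr
      ring_nf at *
      linarith

lemma binary_form_eq_sum_two_sq (A B C : ℤ) (hA : 0 < A) (hD : A * C - B ^ 2 = 1) (y z : ℤ) :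
    ∃ u v : ℤ, A * y ^ 2 + 2 * B * y * z + C * z ^ 2 = u ^ 2 + v ^ 2 := by
  obtain ⟨p, q, r, s, hdet, hpos, hle⟩ :=
    exists_unimodular_small_leading_coeff A B C hA (by omega)
  obtain ⟨m, hm⟩ : ∃ m, m = A * p ^ 2 + 2 * B * p * r + C * r ^ 2 := ⟨_, rfl⟩
  rw [← hm, hD] at hle
  rw [← hm] at hpos
  have hm1 : m = 1 := by nlinarith
  obtain ⟨b, hb⟩ : ∃ b, b = A * p * q + B * (p * s + q * r) + C * r * s := ⟨_, rfl⟩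
  obtain ⟨c, hc⟩ : ∃ c, c = A * q ^ 2 + 2 * B * q * s + C * s ^ 2 := ⟨_, rfl⟩
  have hdet' : m * c - b ^ 2 = 1 := by
    have : m * c - b ^ 2 = (A * C - B ^ 2) * (p * s - q * r) ^ 2 := by rw [hm, hb, hc]; ring
    rw [this, hD, hdet]; norm_num
  obtain ⟨Y, hY⟩ : ∃ Y, Y = s * y - q * z := ⟨_, rfl⟩
  obtain ⟨Z, hZ⟩ : ∃ Z, Z = p * z - r * y := ⟨_, rfl⟩
  have hy : y = p * Y + q * Z := by rw [hY, hZ]; linear_combination (-y) * hdet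
  have hz : z = r * Y + s * Z := by rw [hY, hZ]; linear_combination (-z) * hdet
  refine ⟨Y + b * Z, Z, ?_⟩
  have h1 : A * y ^ 2 + 2 * B * y * z + C * z ^ 2 = m * Y ^ 2 + 2 * b * Y * Z + c * Z ^ 2 := by
    rw [hy, hz, hm, hb, hc]; ring
  rw [h1]
  rw [hm1] at hdet' ⊢
  linear_combination Z ^ 2 * hdet'

/-- Hermite's estimate: a reduced positive ternary form of determinant one with leading
coefficient `a ≠ 1` has a smaller second diagonal coefficient. -/
lemma lt_of_reduced {a b t : ℤ} (ha : 1 < a) (h1 : -a ≤ 2 * t) (h2 : 2 * t ≤ a)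
    (hle : 3 * (a * b - t ^ 2) ^ 2 ≤ 4 * a) : b < a := by
  by_contra! hge
  have hsq : 4 * t ^ 2 ≤ a ^ 2 := by nlinarith
  have h3 : 3 * a ^ 2 ≤ 4 * (a * b - t ^ 2) := by nlinarith
  have h4 : (3 * a ^ 2) ^ 2 ≤ (4 * (a * b - t ^ 2)) ^ 2 := by gcongr
  have h5 : a * (27 * a ^ 3) ≤ a * 64 := by linarith
  have h6 : 27 * a ^ 3 ≤ 64 := le_of_mul_le_mul_left h5 (by omega)
  have h7 : 2 ^ 3 ≤ a ^ 3 := by gcongr; omega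
  omega

/-- A positive definite ternary integral form of determinant one only takes values that are sums of
three squares. -/
lemma ternary_form_eq_sum_three_sq (a b c r s t : ℤ) (ha : 0 < a) (hab : 0 < a * b - t ^ 2)
    (hdet : a * (b * c - r ^ 2) - t * (t * c - r * s) + s * (t * r - b * s) = 1) (x y z : ℤ) :
    ∃ u v w : ℤ, a * x ^ 2 + b * y ^ 2 + c * z ^ 2 + 2 * r * y * z + 2 * s * x * z + 2 * t * x * y =
      u ^ 2 + v ^ 2 + w ^ 2 := by
  induction hN : a.toNat using Nat.strong_induction_on generalizing a b c r s t x y z with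
  | _ N ih =>
    obtain ⟨A, hA⟩ : ∃ A, A = a * b - t ^ 2 := ⟨_, rfl⟩
    obtain ⟨B, hB⟩ : ∃ B, B = a * r - s * t := ⟨_, rfl⟩
    obtain ⟨C, hC⟩ : ∃ C, C = a * c - s ^ 2 := ⟨_, rfl⟩
    have hABC : A * C - B ^ 2 = a := by
      rw [hA, hB, hC]; linear_combination a * hdet
    by_cases ha1 : a = 1
    · subst ha1
      obtain ⟨u, v, huv⟩ := binary_form_eq_sum_two_sq A B C (by omega) hABC y z
      refine ⟨x + t * y + s * z, u, v, ?_⟩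
      rw [hA, hB, hC] at huv
      linear_combination huv
    obtain ⟨p, q, p', q', hunit, hpos, hle⟩ :=
      exists_unimodular_small_leading_coeff A B C (by omega) (by omega)
    rw [hABC] at hle
    obtain ⟨A', hA'⟩ : ∃ A', A' = A * p ^ 2 + 2 * B * p * p' + C * p' ^ 2 := ⟨_, rfl⟩
    rw [← hA'] at hpos hle
    obtain ⟨T, hT⟩ : ∃ T, T = t * p + s * p' := ⟨_, rfl⟩
    obtain ⟨k, h1, h2⟩ : ∃ k : ℤ, -a ≤ 2 * (T - k * a) ∧ 2 * (T - k * a) ≤ a := by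
      refine ⟨(2 * T + a) / (2 * a), ?_, ?_⟩
      · linarith [Int.mul_ediv_self_le (x := 2 * T + a) (k := 2 * a) (by omega)]
      · linarith [Int.lt_mul_ediv_self_add (x := 2 * T + a) (k := 2 * a) (by omega)]
    obtain ⟨t', ht'⟩ : ∃ t', t' = T - k * a := ⟨_, rfl⟩
    rw [← ht'] at h1 h2
    -- the coefficients of the form in the new basis
    obtain ⟨b', hb'⟩ : ∃ b', b' = b * p ^ 2 + 2 * r * p * p' + c * p' ^ 2 - 2 * k * T + k ^ 2 * a :=
      ⟨_, rfl⟩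
    obtain ⟨c', hc'⟩ : ∃ c', c' = b * q ^ 2 + 2 * r * q * q' + c * q' ^ 2 := ⟨_, rfl⟩
    obtain ⟨s', hs'⟩ : ∃ s', s' = t * q + s * q' := ⟨_, rfl⟩
    obtain ⟨r', hr'⟩ : ∃ r', r' = b * p * q + r * (p * q' + q * p') + c * p' * q' - k * s' :=
      ⟨_, rfl⟩
    have hmin : a * b' - t' ^ 2 = A' := by
      rw [hb', ht', hA', hA, hB, hC, hT]; ring
    have hdet' : a * (b' * c' - r' ^ 2) - t' * (t' * c' - r' * s') + s' * (t' * r' - b' * s') =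
        1 := by
      have : a * (b' * c' - r' ^ 2) - t' * (t' * c' - r' * s') + s' * (t' * r' - b' * s') =
          (a * (b * c - r ^ 2) - t * (t * c - r * s) + s * (t * r - b * s)) *
            (p * q' - q * p') ^ 2 := by
        rw [hr', hb', ht', hc', hs', hT]; ring
      rw [this, hdet, hunit]; norm_num
    have hb'pos : 0 < b' := by
      by_contra! hneg
      nlinarith only [sq_nonneg t', hneg, hmin, hpos, ha]
    have hlt : b' < a := lt_of_reduced (by omega) h1 h2 (hmin ▸ hle)
    obtain ⟨Y, hY⟩ : ∃ Y, Y = q' * y - q * z := ⟨_, rfl⟩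
    obtain ⟨Z, hZ⟩ : ∃ Z, Z = p * z - p' * y := ⟨_, rfl⟩
    have hy : y = p * Y + q * Z := by rw [hY, hZ]; linear_combination (-y) * hunit
    have hz : z = p' * Y + q' * Z := by rw [hY, hZ]; linear_combination (-z) * hunit
    obtain ⟨u, v, w, h⟩ := ih b'.toNat (by omega) b' a c' s' r' t' hb'pos (by linarith)
      (by linarith) Y (x + k * Y) Z rfl
    refine ⟨u, v, w, h ▸ ?_⟩
    rw [hy, hz, hr', hb', ht', hc', hs', hT]
    ring

/-- Numbers congruent to `2` modulo `4` are sums of three squares. -/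
lemma sum_three_sq_of_mod_four_eq_two (n : ℕ) (hn : n % 4 = 2) :
    ∃ x y z : ℤ, (n : ℤ) = x ^ 2 + y ^ 2 + z ^ 2 := by
  have hcop : (n - 1).Coprime (4 * n) := by
    refine Nat.Coprime.mul_right ?_ ?_
    · exact Nat.Coprime.pow_right 2
        (Nat.coprime_two_right.mpr (Nat.odd_iff.mpr (by omega)))
    · exact ((Nat.coprime_self_sub_left (by omega)).mpr (Nat.coprime_one_left n))
  obtain ⟨p, hpn, hp, hmod⟩ :=
    Nat.forall_exists_prime_gt_and_modEq n (q := 4 * n) (by omega) hcop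
  obtain ⟨v, hv⟩ := (Nat.modEq_iff_dvd' (by omega)).mp hmod.symm
  have hpv : p + 1 = (4 * v + 1) * n := by
    have : p = n - 1 + 4 * n * v := by omega
    rw [this, add_mul, one_mul]
    have : 4 * v * n = 4 * n * v := by ring
    omega
  have hp4 : p % 4 = 1 := by
    have : p = n - 1 + 4 * (n * v) := by rw [← mul_assoc]; omega
    omega
  have : Fact p.Prime := ⟨hp⟩
  have hb : Odd (4 * v + 1) := Nat.odd_iff.mpr (by omega)
  have hpo : Odd p := Nat.odd_iff.mpr (by omega)
  have hJ : jacobiSym (-((4 * v + 1 : ℕ) : ℤ)) p = 1 := by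
    rw [jacobiSym.neg _ hpo, ZMod.χ₄_nat_one_mod_four hp4, one_mul,
      jacobiSym.quadratic_reciprocity_one_mod_four (by omega) hpo,
      jacobiSym.mod_left' (a₂ := -1), jacobiSym.at_neg_one hb,
      ZMod.χ₄_nat_one_mod_four (by omega)]
    rw [Int.emod_eq_emod_iff_emod_sub_eq_zero]
    exact Int.emod_eq_zero_of_dvd ⟨n, by rw [sub_neg_eq_add]; exact_mod_cast hpv⟩
  obtain ⟨t, ht⟩ := ZMod.isSquare_of_jacobiSym_eq_one hJ
  obtain ⟨t, rfl⟩ := ZMod.intCast_surjective t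
  have hdvd : (p : ℤ) ∣ t ^ 2 + ((4 * v + 1 : ℕ) : ℤ) := by
    rw [← ZMod.intCast_zmod_eq_zero_iff_dvd]
    push_cast at ht ⊢
    linear_combination -ht
  obtain ⟨A, hA⟩ := hdvd
  have hpv' : (p : ℤ) + 1 = (4 * v + 1) * n := by exact_mod_cast hpv
  have hppos : (0 : ℤ) < p := by exact_mod_cast hp.pos
  push_cast at hA
  have hApos : 0 < A := by
    refine pos_of_mul_pos_right (a := (p : ℤ)) ?_ hppos.le
    rw [← hA]; positivity
  obtain ⟨x, y, z, h⟩ := ternary_form_eq_sum_three_sq A p n 0 1 t hApos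
    (by nlinarith) (by linear_combination -n * hA - hpv') 0 0 1
  exact ⟨x, y, z, by linear_combination h⟩

lemma exists_sq_eq_and_emod_seven {X Y c : ℤ} (h : (7 : ℤ) ∣ Y ^ 2 - (c * X) ^ 2) :
    ∃ Y' : ℤ, Y' ^ 2 = Y ^ 2 ∧ (2 : ℤ) ∣ Y' - Y ∧ (7 : ℤ) ∣ Y' - c * X := by
  rw [sq_sub_sq] at h
  rcases (Int.prime_ofNat_iff.mpr (by norm_num : Nat.Prime 7)).dvd_mul.mp h with h | h
  · exact ⟨-Y, by ring, ⟨-Y, by ring⟩, by rw [← dvd_neg]; convert h using 1; ring⟩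
  · exact ⟨Y, rfl, by simp, h⟩

lemma exists_orthogonal_of_sq_dvd {X Y Z n : ℤ} (h : X ^ 2 + Y ^ 2 + Z ^ 2 = 14 * n)
    (hX : X % 2 = 1) (hY : Y % 2 = 0) (hZ : Z % 2 = 1)
    (hY7 : (7 : ℤ) ∣ Y ^ 2 - (2 * X) ^ 2) (hZ7 : (7 : ℤ) ∣ Z ^ 2 - (3 * X) ^ 2) :
    ∃ x y z w : ℤ, n = x ^ 2 + y ^ 2 + z ^ 2 + w ^ 2 ∧ x + 2 * y + 3 * z = 0 := by
  obtain ⟨Y', hYsq, hY2, hYX⟩ := exists_sq_eq_and_emod_seven hY7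
  obtain ⟨Z', hZsq, hZ2, hZX⟩ := exists_sq_eq_and_emod_seven hZ7
  rw [← hYsq, ← hZsq] at h
  obtain ⟨i, hi⟩ : (14 : ℤ) ∣ Y' - 2 * X := by omega
  obtain ⟨j, hj⟩ : (14 : ℤ) ∣ Z' - 3 * X := by omega
  refine ⟨3 * i - 2 * j, j, -i, X + 2 * i + 3 * j, ?_, by ring⟩
  obtain rfl : Y' = 2 * X + 14 * i := by omega
  obtain rfl : Z' = 3 * X + 14 * j := by omega
  linarith

lemma sq_ratio_zmod_seven : ∀ x y z : ZMod 7, x ^ 2 + y ^ 2 + z ^ 2 = 0 →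
    (y ^ 2 - (2 * x) ^ 2 = 0 ∧ z ^ 2 - (3 * x) ^ 2 = 0) ∨
      (y ^ 2 - (2 * z) ^ 2 = 0 ∧ x ^ 2 - (3 * z) ^ 2 = 0) := by
  decide

lemma exists_orthogonal_of_even {X Y Z n : ℤ} (h : X ^ 2 + Y ^ 2 + Z ^ 2 = 14 * n)
    (hX : X % 2 = 1) (hY : Y % 2 = 0) (hZ : Z % 2 = 1) :
    ∃ x y z w : ℤ, n = x ^ 2 + y ^ 2 + z ^ 2 + w ^ 2 ∧ x + 2 * y + 3 * z = 0 := by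
  have h7 : (X : ZMod 7) ^ 2 + (Y : ZMod 7) ^ 2 + (Z : ZMod 7) ^ 2 = 0 := by
    have : ((X ^ 2 + Y ^ 2 + Z ^ 2 : ℤ) : ZMod 7) = 0 :=
      (ZMod.intCast_zmod_eq_zero_iff_dvd _ 7).mpr ⟨2 * n, by rw [h]; push_cast; ring⟩
    exact_mod_cast this
  rcases sq_ratio_zmod_seven _ _ _ h7 with ⟨h1, h2⟩ | ⟨h1, h2⟩
  · exact exists_orthogonal_of_sq_dvd h hX hY hZ
      ((ZMod.intCast_zmod_eq_zero_iff_dvd _ 7).mp (by exact_mod_cast h1))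
      ((ZMod.intCast_zmod_eq_zero_iff_dvd _ 7).mp (by exact_mod_cast h2))
  · exact exists_orthogonal_of_sq_dvd (X := Z) (Z := X) (by linarith) hZ hY hX
      ((ZMod.intCast_zmod_eq_zero_iff_dvd _ 7).mp (by exact_mod_cast h1))
      ((ZMod.intCast_zmod_eq_zero_iff_dvd _ 7).mp (by exact_mod_cast h2))

lemma exists_orthogonal_of_odd (n : ℕ) (hn : n % 2 = 1) :
    ∃ x y z w : ℤ, (n : ℤ) = x ^ 2 + y ^ 2 + z ^ 2 + w ^ 2 ∧ x + 2 * y + 3 * z = 0 := by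
  obtain ⟨X, Y, Z, h⟩ := sum_three_sq_of_mod_four_eq_two (14 * n) (by omega)
  push_cast at h
  have hsq : ∀ a : ℤ, (a % 2 = 0 ∧ a ^ 2 % 4 = 0) ∨ (a % 2 = 1 ∧ a ^ 2 % 4 = 1) := by
    intro a
    rcases Int.emod_two_eq_zero_or_one a with ha | ha
    · exact .inl ⟨ha, Int.emod_eq_zero_of_dvd (pow_dvd_pow_of_dvd (Int.dvd_of_emod_eq_zero ha) 2)⟩
    · exact .inr ⟨ha, Int.sq_mod_four_eq_one_of_odd (Int.odd_iff.mpr ha)⟩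
  rcases hsq X with hX | hX <;> rcases hsq Y with hY | hY <;> rcases hsq Z with hZ | hZ <;>
    first
    | omega
    | exact exists_orthogonal_of_even (X := X) (Y := Y) (Z := Z) (by linarith) hX.1 hY.1 hZ.1
    | exact exists_orthogonal_of_even (X := Y) (Y := X) (Z := Z) (by linarith) hY.1 hX.1 hZ.1
    | exact exists_orthogonal_of_even (X := X) (Y := Z) (Z := Y) (by linarith) hX.1 hZ.1 hY.1

theorem stmt_15 (n : ℕ) :
    ∃ x y z w : ℤ, (n : ℤ) = x ^ 2 + y ^ 2 + z ^ 2 + w ^ 2 ∧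
      w * (x + 2 * y + 3 * z) = 0 := by
  induction n using Nat.strong_induction_on with
  | _ n ih =>
    rcases Nat.eq_zero_or_pos n with rfl | hpos
    · exact ⟨0, 0, 0, 0, by simp⟩
    obtain hodd | h2 | h0 : n % 2 = 1 ∨ n % 4 = 2 ∨ n % 4 = 0 := by omega
    · obtain ⟨x, y, z, w, h, h'⟩ := exists_orthogonal_of_odd n hodd
      exact ⟨x, y, z, w, h, by rw [h', mul_zero]⟩
    · obtain ⟨x, y, z, h⟩ := sum_three_sq_of_mod_four_eq_two n h2
      exact ⟨x, y, z, 0, by linarith, zero_mul _⟩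
    · obtain ⟨m, rfl⟩ := Nat.dvd_of_mod_eq_zero h0
      obtain ⟨x, y, z, w, h, h'⟩ := ih m (by omega)
      exact ⟨2 * x, 2 * y, 2 * z, 2 * w, by push_cast; linear_combination 4 * h,
        by linear_combination 4 * h'⟩
end

section
/- Let λ ∈ {1,2,4} and m ∈ {2,3}. Then every natural number n can be written as n = x^2 + y^2 + z^2 + w^2 with x, y, z, w integers such that x + 2y + 3z = λ·r^m for some nonnegative integer r. -/
/-- A positive definite integral ternary form of determinant one represents only sums of three
squares. -/
theorem ternary_form_eq_sum_three_squares (N : ℕ) : ∀ a b c r s t : ℤ, 0 < a → 0 < a * b - t ^ 2 →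
    a * b * c + 2 * r * s * t - a * r ^ 2 - b * s ^ 2 - c * t ^ 2 = 1 →
    a + (a * b - t ^ 2) ≤ N → ∀ x y z : ℤ, ∃ u v w : ℤ,
      a * x ^ 2 + b * y ^ 2 + c * z ^ 2 + 2 * r * y * z + 2 * s * x * z + 2 * t * x * y =
        u ^ 2 + v ^ 2 + w ^ 2 := by
  induction N with
  | zero => intros; omega
  | succ N ih =>
    intro a b c r s t ha hA hdet hN x y z
    push_cast at hN
    have round : ∀ p q : ℤ, 0 < q → ∃ k : ℤ, 4 * (p - k * q) ^ 2 ≤ q ^ 2 := by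
      intro p q hq
      refine ⟨(2 * p + q) / (2 * q), ?_⟩
      have h1 := Int.mul_ediv_add_emod (2 * p + q) (2 * q)
      have h2 := Int.emod_nonneg (2 * p + q) (b := 2 * q) (by omega)
      have h3 := Int.emod_lt_of_pos (2 * p + q) (b := 2 * q) (by omega)
      set k := (2 * p + q) / (2 * q)
      nlinarith
    obtain ⟨k, hk⟩ := round t a ha
    by_cases hb : b - 2 * t * k + k ^ 2 * a < a
    · have hpos : 0 < a * (b - 2 * t * k + k ^ 2 * a) := by nlinarith [sq_nonneg (t - k * a)]
      obtain ⟨u, v, w, h⟩ := ih (b - 2 * t * k + k ^ 2 * a) a c s (r - k * s) (t - k * a)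
        (pos_of_mul_pos_right hpos ha.le) (by linarith) (by linarith) (by linarith)
        y (x + k * y) z
      exact ⟨u, v, w, by linarith⟩
    have haA : 3 * a ^ 2 ≤ 4 * (a * b - t ^ 2) := by
      nlinarith [mul_le_mul_of_nonneg_left (not_lt.1 hb) ha.le]
    obtain ⟨k, hk⟩ := round (a * r - s * t) (a * b - t ^ 2) hA
    have hdet' : (a * b - t ^ 2) * (a * c - s ^ 2) - (a * r - s * t) ^ 2 = a := by
      linear_combination a * hdet
    by_cases hB : a * (c - 2 * r * k + k ^ 2 * b) - (s - k * t) ^ 2 < a * b - t ^ 2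
    · have hpos : 0 < (a * b - t ^ 2) * (a * (c - 2 * r * k + k ^ 2 * b) - (s - k * t) ^ 2) := by
        nlinarith [sq_nonneg (a * r - s * t - k * (a * b - t ^ 2))]
      obtain ⟨u, v, w, h⟩ := ih a (c - 2 * r * k + k ^ 2 * b) b (r - k * b) t (s - k * t)
        ha (pos_of_mul_pos_right hpos hA.le) (by linarith) (by linarith) x z (y + k * z)
      exact ⟨u, v, w, by linarith⟩
    have hAa : 3 * (a * b - t ^ 2) ^ 2 ≤ 4 * a := by
      nlinarith [mul_le_mul_of_nonneg_left (not_lt.1 hB) hA.le]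
    generalize hAdef : a * b - t ^ 2 = A at *
    have ha1 : a = 1 := by
      by_contra hne
      have h2 : 2 ≤ a := by omega
      have : 2 ≤ A := by nlinarith
      nlinarith
    have hA1 : A = 1 := by
      subst ha1
      nlinarith
    subst ha1 hA1
    refine ⟨x + t * y + s * z, y + (r - s * t) * z, z, ?_⟩
    linear_combination z ^ 2 * hdet' + y ^ 2 * hAdef

theorem sum_three_squares_of_dvd {n d b : ℤ} (hd : 0 < d) (hn : 1 < d * n)
    (h : d * n - 1 ∣ b ^ 2 + d) : ∃ u v w : ℤ, n = u ^ 2 + v ^ 2 + w ^ 2 := by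
  obtain ⟨a, ha⟩ := h
  have hpos : 0 < (d * n - 1) * a := by rw [← ha]; positivity
  have hapos : 0 < a := pos_of_mul_pos_right hpos (by linarith)
  have hA : a * (d * n - 1) - b ^ 2 = d := by linarith
  obtain ⟨u, v, w, h⟩ := ternary_form_eq_sum_three_squares (a + d).toNat a (d * n - 1) n 0 1 b
    hapos (by linarith) (by linear_combination n * hA) (by rw [hA]; omega) 0 0 1
  exact ⟨u, v, w, by linarith⟩

theorem exists_dvd_sq_add_of_jacobiSym {p d : ℕ} (hp : p.Prime)
    (hp2 : p % 2 = 1) (hd2 : d % 2 = 1)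
    (hpd : p % 4 = 1 ∨ p % 4 = 3 ∧ d % 4 = 3) (h : jacobiSym p d = 1) :
    ∃ b : ℤ, (p : ℤ) ∣ b ^ 2 + d := by
  have : Fact p.Prime := ⟨hp⟩
  have hpo : Odd p := Nat.odd_iff.2 hp2
  have hdo : Odd d := Nat.odd_iff.2 hd2
  have h1 : jacobiSym (-d) p = 1 := by
    rw [jacobiSym.neg _ hpo]
    rcases hpd with h4 | ⟨h4, h4'⟩
    · rw [ZMod.χ₄_nat_one_mod_four h4, jacobiSym.quadratic_reciprocity_one_mod_four' hdo h4, h]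
      rfl
    · rw [ZMod.χ₄_nat_three_mod_four h4,
        jacobiSym.quadratic_reciprocity_three_mod_four h4' h4, h]
      rfl
  rw [← jacobiSym.legendreSym.to_jacobiSym] at h1
  have hne : ((-d : ℤ) : ZMod p) ≠ 0 := by
    intro h0
    rw [(legendreSym.eq_zero_iff p _).2 h0] at h1
    exact zero_ne_one h1
  obtain ⟨y, hy⟩ := (legendreSym.eq_one_iff p hne).1 h1
  refine ⟨(y.val : ℤ), ?_⟩
  rw [← ZMod.intCast_zmod_eq_zero_iff_dvd]
  push_cast at hy ⊢
  rw [ZMod.natCast_zmod_val]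
  linear_combination -hy

theorem exists_prime_eq_mul_add {q a : ℕ} (hq : q ≠ 0) (h : a.Coprime q) :
    ∃ p j : ℕ, p.Prime ∧ p = q * j + a := by
  have : NeZero q := ⟨hq⟩
  obtain ⟨p, hpa, hp, hmod⟩ := Nat.forall_exists_prime_gt_and_eq_mod
    ((ZMod.isUnit_iff_coprime a q).2 h) a
  obtain ⟨j, hj⟩ := (Nat.modEq_iff_dvd' hpa.le).1 ((ZMod.natCast_eq_natCast_iff _ _ _).1 hmod).symm
  exact ⟨p, j, hp, by omega⟩

theorem sum_three_squares_of_mod_four_eq_two {n : ℕ} (hn : n % 4 = 2) :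
    ∃ u v w : ℤ, (n : ℤ) = u ^ 2 + v ^ 2 + w ^ 2 := by
  have hcop : (n - 1).Coprime (4 * n) := by
    refine Nat.Coprime.mul_right (Nat.Coprime.pow_right 2 (m := 2) ?_) ?_
    · exact Nat.coprime_two_right.2 (Nat.odd_iff.2 (by omega))
    · have := Nat.coprime_self_add_right (m := n - 1) (n := 1)
      rw [show n - 1 + 1 = n by omega] at this
      exact this.2 (Nat.coprime_one_right _)
  obtain ⟨p, j, hp, hpj⟩ := exists_prime_eq_mul_add (by omega) hcop
  have hp4 : p % 4 = 1 := by rw [mul_assoc] at hpj; omega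
  have hZ : (p : ℤ) = (4 * j + 1 : ℕ) * n - 1 := by
    rw [hpj]; push_cast [show 1 ≤ n by omega]; ring
  have hd : Odd (4 * j + 1) := Nat.odd_iff.2 (by omega)
  obtain ⟨b, hb⟩ := exists_dvd_sq_add_of_jacobiSym (d := 4 * j + 1) hp (by omega) (by omega)
    (Or.inl hp4) (by
      rw [jacobiSym.mod_left' (a₂ := -1) (by rw [hZ, sub_eq_neg_add, Int.add_mul_emod_self_left]),
        jacobiSym.at_neg_one hd, ZMod.χ₄_nat_one_mod_four (by omega)])
  rw [hZ] at hb
  have := hp.two_le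
  exact sum_three_squares_of_dvd (by positivity) (by omega) hb

theorem sum_three_squares_of_odd {n : ℕ} (hn : n % 2 = 1) (hn7 : n % 8 ≠ 7) :
    ∃ u v w : ℤ, (n : ℤ) = u ^ 2 + v ^ 2 + w ^ 2 := by
  obtain ⟨c, hc⟩ : ∃ c, (c = 1 ∧ n % 8 = 3) ∨ (c = 3 ∧ (n % 8 = 1 ∨ n % 8 = 5)) := by
    by_cases h : n % 8 = 3
    · exact ⟨1, by omega⟩
    · exact ⟨3, by omega⟩
  obtain ⟨a, ha⟩ : ∃ a, c * n = 2 * a + 1 := by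
    refine ⟨(c * n - 1) / 2, ?_⟩
    rcases hc with ⟨rfl, h⟩ | ⟨rfl, h⟩ <;> omega
  have ha2 : a % 4 = 1 ∨ a % 4 = 3 ∧ c = 3 := by
    rcases hc with ⟨rfl, h⟩ | ⟨rfl, h⟩ <;> omega
  have hcop : a.Coprime (4 * n) := by
    refine Nat.Coprime.mul_right (Nat.Coprime.pow_right 2 (m := 2) ?_) ?_
    · exact Nat.coprime_two_right.2 (Nat.odd_iff.2 (by omega))
    · refine Nat.Coprime.coprime_mul_left_right (k := c) ?_
      rw [ha]
      simp
  obtain ⟨p, j, hp, hpj⟩ := exists_prime_eq_mul_add (by omega) hcop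
  have hp4 : p % 4 = a % 4 := by rw [mul_assoc] at hpj; omega
  have hZ : 2 * (p : ℤ) = (8 * j + c : ℕ) * n - 1 := by
    rw [hpj]; push_cast; zify at ha; linear_combination -ha
  have hd : Odd (8 * j + c) := Nat.odd_iff.2 (by omega)
  obtain ⟨b, hb⟩ := exists_dvd_sq_add_of_jacobiSym (d := 8 * j + c) hp (by omega) (by omega)
    (by omega) (by
      have h2p : jacobiSym (2 * p) (8 * j + c) = jacobiSym (-1) (8 * j + c) :=
        jacobiSym.mod_left' (by rw [hZ, sub_eq_neg_add, Int.add_mul_emod_self_left])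
      rw [jacobiSym.mul_left, jacobiSym.at_two hd, jacobiSym.at_neg_one hd] at h2p
      rw [ZMod.χ₈_nat_mod_eight, ZMod.χ₄_nat_mod_four] at h2p
      rcases hc with ⟨rfl, h⟩ | ⟨rfl, h⟩
      · rw [show (8 * j + 1) % 8 = 1 by omega, show (8 * j + 1) % 4 = 1 by omega] at h2p
        have e1 : ZMod.χ₈ ((1 : ℕ) : ZMod 8) = 1 := by decide
        have e2 : ZMod.χ₄ ((1 : ℕ) : ZMod 4) = 1 := by decide
        rw [e1, e2] at h2p
        linarith
      · rw [show (8 * j + 3) % 8 = 3 by omega, show (8 * j + 3) % 4 = 3 by omega] at h2p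
        have e1 : ZMod.χ₈ ((3 : ℕ) : ZMod 8) = -1 := by decide
        have e2 : ZMod.χ₄ ((3 : ℕ) : ZMod 4) = -1 := by decide
        rw [e1, e2] at h2p
        linarith)
  obtain ⟨b', hb', hodd⟩ : ∃ b' : ℤ, (p : ℤ) ∣ b' ^ 2 + (8 * j + c : ℕ) ∧ b' % 2 = 1 := by
    rcases Int.emod_two_eq_zero_or_one b with h | h
    · refine ⟨b + p, ?_, by omega⟩
      obtain ⟨q, hq⟩ := hb
      exact ⟨q + 2 * b + p, by linear_combination hq⟩
    · exact ⟨b, hb, h⟩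
  have h2 : (2 : ℤ) ∣ b' ^ 2 + (8 * j + c : ℕ) := by
    obtain ⟨e, he⟩ : Odd (b' ^ 2) := (Int.odd_iff.2 hodd).pow
    omega
  have h2p : (8 * j + c : ℕ) * (n : ℤ) - 1 ∣ b' ^ 2 + (8 * j + c : ℕ) := by
    rw [← hZ]
    refine IsCoprime.mul_dvd ?_ h2 hb'
    exact Int.isCoprime_iff_gcd_eq_one.2 (Nat.coprime_two_left.2
      (Nat.odd_iff.2 (by omega)))
  have := hp.two_le
  exact sum_three_squares_of_dvd (by omega) (by omega) h2p

/-- Modulo seven, an isotropic quaternion is a left multiple of one of the eight quaternions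
`1 ± 3i ± 2j`, `1 ± 3i ± 2k`. -/
theorem isotropic_mod_seven : ∀ a b c d : ZMod 7, a * a + b * b + c * c + d * d = 0 →
    ∃ e ∈ [(3 : ℤ), -3], ∃ f ∈ [((2 : ℤ), (0 : ℤ)), (-2, 0), (0, 2), (0, -2)],
      a + b * e + c * f.1 + d * f.2 = 0 ∧ b - a * e - c * f.2 + d * f.1 = 0 ∧
      c - a * f.1 + b * f.2 - d * e = 0 ∧ d - a * f.2 - b * f.1 + c * e = 0 := by
  decide +kernel

/-- Dividing the quaternion `s + Ai + Bj + Ck` on the right by a suitable quaternion of norm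
fourteen turns a decomposition of `14n` into one of `n` with `x + 2y + 3z` prescribed. -/
theorem exists_four_squares_weighted_of_parity {n s A B C : ℤ}
    (h : 14 * n = s ^ 2 + A ^ 2 + B ^ 2 + C ^ 2) (hsA : s % 2 = A % 2) (hBC : B % 2 = C % 2) :
    ∃ x y z w : ℤ, n = x ^ 2 + y ^ 2 + z ^ 2 + w ^ 2 ∧ x + 2 * y + 3 * z = s := by
  have h7 : (s : ZMod 7) * s + A * A + B * B + C * C = 0 := by
    have h0 : ((s * s + A * A + B * B + C * C : ℤ) : ZMod 7) = 0 :=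
      (ZMod.intCast_zmod_eq_zero_iff_dvd _ 7).2 ⟨2 * n, by push_cast; linear_combination -h⟩
    exact_mod_cast h0
  obtain ⟨e, he, ⟨f, g⟩, hfg, h0, h1, h2, h3⟩ := isotropic_mod_seven _ _ _ _ h7
  norm_cast at h0 h1 h2 h3
  rw [ZMod.intCast_zmod_eq_zero_iff_dvd] at h0 h1 h2 h3
  have key : ∃ p q r t : ℤ, s + A * e + B * f + C * g = 14 * p ∧
      A - s * e - B * g + C * f = 14 * q ∧ B - s * f + A * g - C * e = 14 * r ∧
      C - s * g - A * f + B * e = 14 * t := by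
    obtain ⟨e', f', g', rfl, rfl, rfl⟩ :
        ∃ e' f' g' : ℤ, e = 2 * e' + 1 ∧ f = 2 * f' ∧ g = 2 * g' := by
      simp only [List.mem_cons, List.not_mem_nil, or_false, Prod.mk.injEq] at he hfg
      exact ⟨e / 2, f / 2, g / 2, by omega, by omega, by omega⟩
    obtain ⟨α, rfl⟩ : ∃ α, A = s + 2 * α := ⟨(A - s) / 2, by omega⟩
    obtain ⟨β, rfl⟩ : ∃ β, C = B + 2 * β := ⟨(C - B) / 2, by omega⟩
    have dvd14 : ∀ X Y : ℤ, X = 2 * Y → ((7 : ℕ) : ℤ) ∣ X → ∃ p, X = 14 * p := by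
      intro X Y h2 h7
      exact ⟨X / 14, by omega⟩
    obtain ⟨p, hp⟩ := dvd14 _ (s + α + (s + 2 * α) * e' + B * f' + (B + 2 * β) * g') (by ring) h0
    obtain ⟨q, hq⟩ := dvd14 _ (α - s * e' - B * g' + (B + 2 * β) * f') (by ring) h1
    obtain ⟨r, hr⟩ := dvd14 _ (-β - (B + 2 * β) * e' - s * f' + (s + 2 * α) * g') (by ring) h2
    obtain ⟨t, ht⟩ := dvd14 _ (B + β + B * e' - s * g' - (s + 2 * α) * f') (by ring) h3
    exact ⟨p, q, r, t, by linarith, by linarith, by linarith, by linarith⟩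
  obtain ⟨p, q, r, t, hp, hq, hr, ht⟩ := key
  have hef : e ^ 2 = 9 ∧ f ^ 2 + g ^ 2 = 4 := by
    simp only [List.mem_cons, List.not_mem_nil, or_false, Prod.mk.injEq] at he hfg
    rcases he with rfl | rfl <;>
      rcases hfg with ⟨rfl, rfl⟩ | ⟨rfl, rfl⟩ | ⟨rfl, rfl⟩ | ⟨rfl, rfl⟩ <;> norm_num
  have hs : p - e * q - f * r - g * t = s := by
    have : 14 * (p - e * q - f * r - g * t) = 14 * s := by
      linear_combination -hp + e * hq + f * hr + g * ht + s * hef.1 + s * hef.2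
    linarith
  have hn : n = p ^ 2 + q ^ 2 + r ^ 2 + t ^ 2 := by
    have : (14 * p) ^ 2 + (14 * q) ^ 2 + (14 * r) ^ 2 + (14 * t) ^ 2 = 14 * 14 * n := by
      rw [← hp, ← hq, ← hr, ← ht]
      linear_combination (s ^ 2 + A ^ 2 + B ^ 2 + C ^ 2) * (hef.1 + hef.2) - 14 * h
    linarith
  simp only [List.mem_cons, List.not_mem_nil, or_false, Prod.mk.injEq] at he hfg
  obtain ⟨z, hz, hez⟩ : ∃ z : ℤ, z ^ 2 = q ^ 2 ∧ 3 * z = -e * q := by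
    rcases he with rfl | rfl
    · exact ⟨-q, by ring, by ring⟩
    · exact ⟨q, by ring, by ring⟩
  obtain ⟨y, w, hy, hfy⟩ : ∃ y w : ℤ, y ^ 2 + w ^ 2 = r ^ 2 + t ^ 2 ∧
      2 * y = -f * r - g * t := by
    rcases hfg with ⟨rfl, rfl⟩ | ⟨rfl, rfl⟩ | ⟨rfl, rfl⟩ | ⟨rfl, rfl⟩
    · exact ⟨-r, t, by ring, by ring⟩
    · exact ⟨r, t, by ring, by ring⟩
    · exact ⟨-t, r, by ring, by ring⟩
    · exact ⟨t, r, by ring, by ring⟩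
  exact ⟨p, y, z, w, by linarith, by linarith⟩

theorem exists_four_squares_weighted {n s A B C : ℤ}
    (h : 14 * n = s ^ 2 + A ^ 2 + B ^ 2 + C ^ 2) :
    ∃ x y z w : ℤ, n = x ^ 2 + y ^ 2 + z ^ 2 + w ^ 2 ∧ x + 2 * y + 3 * z = s := by
  have sq_parity : ∀ a : ℤ, a ^ 2 % 2 = a % 2 := by
    intro a
    rcases Int.emod_two_eq_zero_or_one a with ha | ha <;> simp [pow_two, Int.mul_emod, ha]
  have hs := sq_parity s
  have hA := sq_parity A
  have hB := sq_parity B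
  have hC := sq_parity C
  by_cases h1 : s % 2 = A % 2
  · exact exists_four_squares_weighted_of_parity h h1 (by omega)
  · by_cases h2 : s % 2 = B % 2
    · exact exists_four_squares_weighted_of_parity (A := B) (B := A) (C := C)
        (by linarith) h2 (by omega)
    · exact exists_four_squares_weighted_of_parity (A := C) (B := A) (C := B)
        (by linarith) (by omega) (by omega)

theorem exists_sum_three_squares_sub (e m k u : ℕ) (he : e ≤ 2) (hm : m = 2 ∨ m = 3)
    (hu : u % 8 = 1) :
    ∃ t : ℕ, ∃ A B C : ℤ,
      4 ^ k * (28 * u : ℤ) = (2 ^ e * (2 ^ t) ^ m) ^ 2 + A ^ 2 + B ^ 2 + C ^ 2 := by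
  obtain ⟨t, j, hj, ht⟩ : ∃ t j : ℕ, j ≤ 2 ∧ e + t * m = k + j := by
    refine ⟨(k + 2 - e) / m, e + (k + 2 - e) / m * m - k, ?_⟩
    rcases hm with rfl | rfl <;> omega
  have hS : ∃ A B C : ℤ, (28 * u : ℤ) = 4 ^ j + A ^ 2 + B ^ 2 + C ^ 2 := by
    interval_cases j
    · obtain ⟨A, B, C, h⟩ := sum_three_squares_of_odd (n := 28 * u - 1) (by omega) (by omega)
      exact ⟨A, B, C, by push_cast [show 1 ≤ 28 * u by omega] at h; linarith⟩
    · obtain ⟨A, B, C, h⟩ := sum_three_squares_of_mod_four_eq_two (n := 7 * u - 1) (by omega)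
      exact ⟨2 * A, 2 * B, 2 * C, by push_cast [show 1 ≤ 7 * u by omega] at h; linarith⟩
    · obtain ⟨A, B, C, h⟩ := sum_three_squares_of_odd (n := 7 * u - 4) (by omega) (by omega)
      exact ⟨2 * A, 2 * B, 2 * C, by push_cast [show 4 ≤ 7 * u by omega] at h; linarith⟩
  obtain ⟨A, B, C, h⟩ := hS
  refine ⟨t, 2 ^ k * A, 2 ^ k * B, 2 ^ k * C, ?_⟩
  have h4 : ∀ i : ℕ, (4 : ℤ) ^ i = (2 ^ i) ^ 2 := fun i => by rw [← pow_mul, mul_comm, pow_mul]; rfl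
  rw [← pow_mul, ← pow_add, ht, pow_add, h, h4 k, h4 j]
  ring


theorem stmt_16 (l : ℤ) (hl : l = 1 ∨ l = 2 ∨ l = 4) (m : ℕ) (hm : m = 2 ∨ m = 3) (n : ℕ) :
    ∃ x y z w : ℤ, (n : ℤ) = x ^ 2 + y ^ 2 + z ^ 2 + w ^ 2 ∧
      ∃ r : ℕ, x + 2 * y + 3 * z = l * (r : ℤ) ^ m := by
  obtain ⟨e, he, rfl⟩ : ∃ e : ℕ, e ≤ 2 ∧ l = 2 ^ e := by
    rcases hl with rfl | rfl | rfl
    exacts [⟨0, by norm_num⟩, ⟨1, by norm_num⟩, ⟨2, by norm_num⟩]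
  have hm0 : m ≠ 0 := by omega
  suffices ∃ r : ℕ, ∃ A B C : ℤ,
      14 * (n : ℤ) = (2 ^ e * (r : ℤ) ^ m) ^ 2 + A ^ 2 + B ^ 2 + C ^ 2 by
    obtain ⟨r, A, B, C, h⟩ := this
    obtain ⟨x, y, z, w, hn, hs⟩ := exists_four_squares_weighted h
    exact ⟨x, y, z, w, hn, r, hs⟩
  rcases Nat.eq_zero_or_pos n with rfl | hn
  · exact ⟨0, 0, 0, 0, by simp [hm0]⟩
  obtain ⟨k, q, hq, rfl⟩ := Nat.exists_eq_pow_mul_and_not_dvd hn.ne' 4 (by norm_num)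
  by_cases hbad : q % 16 = 2
  · obtain ⟨u, rfl⟩ : ∃ u, q = 2 * u := ⟨q / 2, by omega⟩
    obtain ⟨t, A, B, C, h⟩ := exists_sum_three_squares_sub e m k u he hm (by omega)
    exact ⟨2 ^ t, A, B, C, by push_cast; linarith⟩
  · have hS : ∃ A B C : ℤ, (14 * q : ℤ) = A ^ 2 + B ^ 2 + C ^ 2 := by
      rcases Nat.even_or_odd' q with ⟨u, rfl | rfl⟩
      · obtain ⟨A, B, C, h⟩ := sum_three_squares_of_odd (n := 7 * u) (by omega) (by omega)
        exact ⟨2 * A, 2 * B, 2 * C, by push_cast at h ⊢; linarith⟩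
      · obtain ⟨A, B, C, h⟩ :=
          sum_three_squares_of_mod_four_eq_two (n := 14 * (2 * u + 1)) (by omega)
        exact ⟨A, B, C, by exact_mod_cast h⟩
    obtain ⟨A, B, C, h⟩ := hS
    refine ⟨0, 2 ^ k * A, 2 ^ k * B, 2 ^ k * C, ?_⟩
    have h4 : (4 : ℤ) ^ k = (2 ^ k) ^ 2 := by rw [← pow_mul, mul_comm, pow_mul]; rfl
    simp only [Nat.cast_zero, zero_pow hm0]
    push_cast
    rw [h4]
    linear_combination (2 ^ k) ^ 2 * h
end
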